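/- There exists ε₀ > 0, depending only on S and k, such that for every k-fission H of S within any ε ≤ ε₀ the following holds: if the halving edges graph G of S is connected, then every connected component of the halving edges graph of H contains vertices in every cluster, and moreover, for any two points v, w of S, each connected component of the halving edges graph of H contains the same number of vertices in the v-cluster as in the w-cluster. -/

import Mathlib

noncomputable section

/-- The plane. -/
abbrev Pt : Type := EuclideanSpace ℝ (Fin 2)

/-- Signed determinant of the triple `(p, q, r)`: positive iff `r` lies on the left of
the directed line from `p` to `q`. -/
def det2 (p q r : Pt) : ℝ :=
  (q 0 - p 0) * (r 1 - p 1) - (q 1 - p 1) * (r 0 - p 0)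

/-- A finite set of points in the plane is in general position if no three of its
(distinct) points are collinear. -/
def GenPos (S : Finset Pt) : Prop :=
  ∀ p ∈ S, ∀ q ∈ S, ∀ r ∈ S, p ≠ q → p ≠ r → q ≠ r →
    ¬ Collinear ℝ ({p, q, r} : Set Pt)

/-- `{p, q}` is a halving edge of `S`: `p, q` are distinct points of `S` and the open
half-planes on the two sides of the line through `p` and `q` each contain exactly
`(|S| - 2)/2` points of `S`. -/
def HalvingEdge (S : Finset Pt) (p q : Pt) : Prop :=
  p ∈ S ∧ q ∈ S ∧ p ≠ q ∧
    {r ∈ (S : Set Pt) | 0 < det2 p q r}.ncard = (S.card - 2) / 2 ∧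
    {r ∈ (S : Set Pt) | det2 p q r < 0}.ncard = (S.card - 2) / 2

/-- The halving edges graph of `S` (as a graph on the whole plane; all vertices
outside `S` are isolated). -/
def halvingGraph (S : Finset Pt) : SimpleGraph Pt :=
  SimpleGraph.fromRel (HalvingEdge S)

/-- The number of halving edges of `S`. -/
def halvingEdgeCount (S : Finset Pt) : ℕ :=
  {e : Sym2 Pt | ∃ p q, e = s(p, q) ∧ HalvingEdge S p q}.ncard

/-- `H`, together with the cluster map `cl`, is a `k`-fission of `S` within `ε`:
`H` is a set of `k * |S|` points in general position partitioned into clusters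
`cl v` of `k` points, one for each `v ∈ S`, with each point of the `v`-cluster
within distance `ε` of `v`. -/
structure IsFission (S : Finset Pt) (k : ℕ) (ε : ℝ) (H : Finset Pt)
    (cl : Pt → Finset Pt) : Prop where
  genPos : GenPos H
  cluster_card : ∀ v ∈ S, (cl v).card = k
  disj : ∀ v ∈ S, ∀ w ∈ S, v ≠ w → Disjoint (cl v) (cl w)
  union_eq : (H : Set Pt) = ⋃ v ∈ S, (cl v : Set Pt)
  close : ∀ v ∈ S, ∀ x ∈ cl v, dist x v ≤ ε

/-- A fission is plain if no halving edge of `H` has both endpoints in the same cluster. -/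
def IsPlain (S : Finset Pt) (H : Finset Pt) (cl : Pt → Finset Pt) : Prop :=
  ∀ v ∈ S, ∀ p ∈ cl v, ∀ q ∈ cl v, ¬ HalvingEdge H p q


local instance : DecidableEq Pt := Classical.decEq _

section

open Finset Filter Topology

/-- The sign of a real number, as an integer. -/
def isign (x : ℝ) : ℤ := (SignType.sign x : ℤ)

lemma isign_pos {x : ℝ} (h : 0 < x) : isign x = 1 := by simp [isign, sign_pos h]

lemma isign_neg_of_neg {x : ℝ} (h : x < 0) : isign x = -1 := by simp [isign, sign_neg h]

lemma isign_zero : isign 0 = 0 := by simp [isign]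

lemma isign_mul (x y : ℝ) : isign (x * y) = isign x * isign y := by
  simp [isign, sign_mul]

lemma isign_neg (x : ℝ) : isign (-x) = -isign x := by
  rcases lt_trichotomy x 0 with h | h | h
  · rw [isign_neg_of_neg h, isign_pos (by linarith)]; rfl
  · simp [h, isign_zero]
  · rw [isign_pos h, isign_neg_of_neg (by linarith)]

lemma isign_eq_one_or {x : ℝ} (h : x ≠ 0) : isign x = 1 ∨ isign x = -1 := by
  rcases lt_or_gt_of_ne h with h | h
  · exact Or.inr (isign_neg_of_neg h)
  · exact Or.inl (isign_pos h)

lemma abs_isign_le_one (x : ℝ) : |isign x| ≤ 1 := by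
  by_cases h : x = 0
  · simp [h, isign_zero]
  · rcases isign_eq_one_or h with h | h <;> simp [h]

lemma even_sum_add_card {ι : Type*} (a : ι → ℤ) (U : Finset ι)
    (hU : ∀ q ∈ U, a q = 1 ∨ a q = -1) : Even (∑ q ∈ U, a q + #U) := by
  rw [card_eq_sum_ones]
  push_cast
  rw [← sum_add_distrib]
  refine even_sum _ fun q hq => ?_
  rcases hU q hq with h | h <;> rw [h] <;> decide

/-- A sequence of `±1` jumps, sorted by `s`, takes the partial-sum walk from `c + ∑ a` to
`c - ∑ a`; the signed number of crossings of zero depends only on the end points. -/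
lemma sum_zero_crossings {ι : Type*} [DecidableEq ι] (s : ι → ℝ) (a : ι → ℤ) (T : Finset ι) :
    Set.InjOn s T → (∀ q ∈ T, a q = 1 ∨ a q = -1) → ∀ c : ℤ, Odd (c + #T) →
    (∑ r ∈ T, if c + ∑ q ∈ T, a q * isign (s q - s r) = 0 then a r else 0) =
      (if 0 < c + ∑ q ∈ T, a q then 1 else 0) - (if 0 < c - ∑ q ∈ T, a q then 1 else 0) := by
  induction T using Finset.induction_on_max_value s with
  | empty => intros; simp
  | insert m T hm hmax ih =>
    intro hinj ha c hodd
    have hlt : ∀ r ∈ T, s r < s m := fun r hr => lt_of_le_of_ne (hmax r hr) fun h =>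
      hm (hinj (by simp [hr]) (by simp) h ▸ hr)
    have ha' : ∀ q ∈ T, a q = 1 ∨ a q = -1 := fun q hq => ha q (by simp [hq])
    have ham := ha m (by simp)
    rw [card_insert_of_notMem hm] at hodd
    push_cast at hodd
    have IH := ih (hinj.mono (by simp)) ha' (c + a m) (by
      rcases ham with h | h <;> rw [h]
      · convert hodd using 1; ring
      · obtain ⟨j, hj⟩ := hodd
        exact ⟨j - 1, by linarith⟩)
    rw [sum_insert hm, sum_insert hm, sum_insert hm]
    have h1 : ∀ r ∈ T, (if c + ∑ q ∈ insert m T, a q * isign (s q - s r) = 0 then a r else 0) =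
        if c + a m + ∑ q ∈ T, a q * isign (s q - s r) = 0 then a r else 0 := by
      intro r hr
      rw [sum_insert hm, isign_pos (sub_pos.2 (hlt r hr)), mul_one, add_assoc]
    have h2 : ∑ q ∈ T, a q * isign (s q - s m) = -∑ q ∈ T, a q := by
      rw [← sum_neg_distrib]
      refine sum_congr rfl fun q hq => ?_
      rw [isign_neg_of_neg (sub_neg.2 (hlt q hq))]; ring
    obtain ⟨i, hi⟩ := even_sum_add_card a T ha'
    obtain ⟨j, hj⟩ := hodd
    rw [sum_congr rfl h1, IH, h2, sub_self, isign_zero]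
    generalize ∑ q ∈ T, a q = z at *
    rcases ham with h | h <;> rw [h] <;> split_ifs <;> omega

lemma sum_isign {ι : Type*} (f : ι → ℝ) (U : Finset ι) :
    ∑ q ∈ U, isign (f q) = (#{q ∈ U | 0 < f q} : ℤ) - #{q ∈ U | f q < 0} := by
  rw [card_filter, card_filter]
  push_cast
  rw [← sum_sub_distrib]
  refine sum_congr rfl fun q _ => ?_
  rcases lt_trichotomy (f q) 0 with h | h | h
  · simp [isign_neg_of_neg h, h, h.not_gt]
  · simp [h, isign_zero]
  · simp [isign_pos h, h, h.not_gt]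

lemma collinear_of_det2_eq_zero {p q r : Pt} (hpq : p ≠ q) (h : det2 p q r = 0) :
    Collinear ℝ ({p, q, r} : Set Pt) := by
  rw [collinear_iff_of_mem (p₀ := p) (by simp)]
  unfold det2 at h
  suffices ∃ t : ℝ, r = t • (q - p) +ᵥ p by
    obtain ⟨t, ht⟩ := this
    refine ⟨q - p, ?_⟩
    rintro x (rfl | rfl | rfl)
    · exact ⟨0, by simp⟩
    · exact ⟨1, by simp⟩
    · exact ⟨t, ht⟩
  by_cases h0 : q 0 - p 0 = 0
  · have h1 : q 1 - p 1 ≠ 0 := by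
      intro h1
      apply hpq
      ext i
      fin_cases i
      · simpa using (sub_eq_zero.1 h0).symm
      · simpa using (sub_eq_zero.1 h1).symm
    refine ⟨(r 1 - p 1) / (q 1 - p 1), ?_⟩
    ext i
    fin_cases i
    · simp only [h0, zero_mul, zero_sub, neg_eq_zero, mul_eq_zero, h1, false_or] at h
      simp [h0]; linarith
    · simp; field_simp; ring
  · refine ⟨(r 0 - p 0) / (q 0 - p 0), ?_⟩
    ext i
    fin_cases i
    · simp; field_simp; ring
    · simp; field_simp; linarith

lemma GenPos.det2_ne_zero {S : Finset Pt} (hS : GenPos S) {p q r : Pt} (hp : p ∈ S) (hq : q ∈ S)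
    (hr : r ∈ S) (hpq : p ≠ q) (hpr : p ≠ r) (hqr : q ≠ r) : det2 p q r ≠ 0 :=
  fun h => hS p hp q hq r hr hpq hpr hqr (collinear_of_det2_eq_zero hpq h)

lemma det2_swap (p q r : Pt) : det2 q p r = -det2 p q r := by unfold det2; ring

lemma HalvingEdge.symm {S : Finset Pt} {p q : Pt} (h : HalvingEdge S p q) :
    HalvingEdge S q p := by
  obtain ⟨hp, hq, hne, h1, h2⟩ := h
  refine ⟨hq, hp, hne.symm, ?_, ?_⟩
  · simpa only [det2_swap p q, neg_pos] using h2
  · simpa only [det2_swap p q, neg_lt_zero] using h1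

lemma ncard_sep_eq_card_filter (S : Finset Pt) (P : Pt → Prop) [DecidablePred P] :
    {r ∈ (S : Set Pt) | P r}.ncard = #{r ∈ S | P r} := by
  rw [← Set.ncard_coe_finset]
  simp

lemma HalvingEdge.sum_isign_eq_zero {S : Finset Pt} {p q : Pt} (h : HalvingEdge S p q) :
    ∑ r ∈ S, isign (det2 p q r) = 0 := by
  obtain ⟨-, -, -, h1, h2⟩ := h
  rw [ncard_sep_eq_card_filter] at h1 h2
  rw [sum_isign, h1, h2, sub_self]

lemma halvingEdge_iff_sum_isign {H : Finset Pt} (hH : GenPos H) (hev : Even #H) {p q : Pt}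
    (hp : p ∈ H) (hq : q ∈ H) (hpq : p ≠ q) :
    HalvingEdge H p q ↔ ∑ r ∈ H, isign (det2 p q r) = 0 := by
  refine ⟨HalvingEdge.sum_isign_eq_zero, fun h => ?_⟩
  rw [sum_isign] at h
  have h3 : #{r ∈ H | det2 p q r = 0} = 2 := by
    rw [← card_pair hpq]
    congr 1
    ext r
    simp only [mem_filter, mem_insert, mem_singleton]
    constructor
    · rintro ⟨hr, h0⟩
      by_contra! hcon
      exact hH.det2_ne_zero hp hq hr hpq hcon.1.symm hcon.2.symm h0
    · rintro (rfl | rfl)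
      · exact ⟨hp, by simp [det2]⟩
      · exact ⟨hq, by simp only [det2]; ring⟩
  have h4 : #{r ∈ H | 0 < det2 p q r} + #{r ∈ H | det2 p q r < 0} + 2 = #H := by
    rw [← h3]
    simp only [card_filter, card_eq_sum_ones H, ← sum_add_distrib]
    refine sum_congr rfl fun r _ => ?_
    rcases lt_trichotomy (det2 p q r) 0 with h | h | h
    · simp [h, h.ne, h.not_gt]
    · simp [h]
    · simp [h, h.ne', h.not_gt]
  obtain ⟨m, hm⟩ := hev
  refine ⟨hp, hq, hpq, ?_, ?_⟩ <;> rw [ncard_sep_eq_card_filter] <;> omega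

/-- The component of `r - p` along `w - v` (scaled by the length of `w - v`). -/
def along (v w p r : Pt) : ℝ :=
  (w 0 - v 0) * (r 0 - p 0) + (w 1 - v 1) * (r 1 - p 1)

/-- The component of `r - p` across `w - v` (scaled by the length of `w - v`). -/
def across (v w p r : Pt) : ℝ :=
  (w 0 - v 0) * (r 1 - p 1) - (w 1 - v 1) * (r 0 - p 0)

lemma along_self_pos {v w : Pt} (h : v ≠ w) : 0 < along v w v w := by
  unfold along
  by_contra! hle
  apply h
  have h0 : w 0 - v 0 = 0 := by nlinarith [sq_nonneg (w 0 - v 0), sq_nonneg (w 1 - v 1)]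
  have h1 : w 1 - v 1 = 0 := by nlinarith [sq_nonneg (w 0 - v 0), sq_nonneg (w 1 - v 1)]
  ext i
  fin_cases i
  · simpa using (sub_eq_zero.1 h0).symm
  · simpa using (sub_eq_zero.1 h1).symm

lemma along_mul_det2 (v w p r q : Pt) :
    along v w v w * det2 p r q =
      along v w p r * across v w p q - across v w p r * along v w p q := by
  unfold along across det2; ring

lemma along_swap (v w p r : Pt) : along v w r p = -along v w p r := by unfold along; ring

lemma across_swap (v w p r : Pt) : across v w r p = -across v w p r := by unfold across; ring

/-- `r` lies in the open double wedge of aperture `δ` at `p` around the direction `w - v`. -/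
def InWedge (v w : Pt) (δ : ℝ) (p r : Pt) : Prop :=
  |across v w p r| < δ * |along v w p r|

lemma InWedge.symm {v w p r : Pt} {δ : ℝ} (h : InWedge v w δ p r) : InWedge v w δ r p := by
  unfold InWedge at *
  rwa [along_swap, across_swap, abs_neg, abs_neg]

lemma InWedge.along_ne_zero {v w p r : Pt} {δ : ℝ} (h : InWedge v w δ p r) :
    along v w p r ≠ 0 := by
  intro h0
  unfold InWedge at h
  rw [h0] at h
  simp at h
  linarith [abs_nonneg (across v w p r)]

lemma InWedge.ne {v w p r : Pt} {δ : ℝ} (h : InWedge v w δ p r) : p ≠ r := by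
  rintro rfl
  exact h.along_ne_zero (by simp [along])

lemma across_ne_zero_of_not_inWedge {v w p r : Pt} {δ : ℝ} (hδ : 0 < δ) (hvw : v ≠ w)
    (hpr : p ≠ r) (h : ¬ InWedge v w δ p r) : across v w p r ≠ 0 := by
  intro h0
  unfold InWedge at h
  rw [h0, abs_zero, not_lt] at h
  have hX : along v w p r = 0 := by
    have : |along v w p r| ≤ 0 := by
      by_contra! hc
      nlinarith [mul_pos hδ hc]
    exact abs_nonpos_iff.1 this
  have h1 := along_mul_det2 v w p r (p + (w - v))
  have h2 := along_self_pos hvw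
  have h3 := along_self_pos hpr
  have key : along v w v w * along p r p r = (along v w p r) ^ 2 + (across v w p r) ^ 2 := by
    unfold along across; ring
  rw [h0, hX] at key
  nlinarith [mul_pos h2 h3]

lemma isign_det2_of_inWedge {v w p r q : Pt} {δ : ℝ} (hvw : v ≠ w)
    (hr : InWedge v w δ p r) (hq : InWedge v w δ p q) :
    isign (det2 p r q) = isign (along v w p r) * (isign (along v w p q) *
      isign (across v w p q / along v w p q - across v w p r / along v w p r)) := by
  have h := along_mul_det2 v w p r q
  have hX := hr.along_ne_zero
  have hX' := hq.along_ne_zero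
  have : along v w v w * det2 p r q = along v w p r * (along v w p q *
      (across v w p q / along v w p q - across v w p r / along v w p r)) := by
    rw [h]; field_simp
  rw [← isign_mul, ← isign_mul, ← this, isign_mul, isign_pos (along_self_pos hvw), one_mul]

lemma isign_det2_of_not_inWedge {v w p r q : Pt} {δ : ℝ} (hδ : 0 < δ) (hvw : v ≠ w)
    (hr : InWedge v w δ p r) (hq : ¬ InWedge v w δ p q) :
    isign (det2 p r q) = isign (along v w p r) * isign (across v w p q) := by
  by_cases hpq : p = q
  · subst hpq
    have h1 : det2 p r p = 0 := by unfold det2; ring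
    have h2 : across v w p p = 0 := by unfold across; ring
    rw [h1, h2, isign_zero, mul_zero]
  have hY := across_ne_zero_of_not_inWedge hδ hvw hpq hq
  have hX := hr.along_ne_zero
  rw [← isign_mul, ← one_mul (isign (det2 p r q)), ← isign_pos (along_self_pos hvw), ← isign_mul,
    along_mul_det2]
  unfold InWedge at hr hq
  rw [not_lt] at hq
  have hlt : |across v w p r * along v w p q| < |along v w p r * across v w p q| := by
    rw [abs_mul, abs_mul]
    have hy : 0 < |across v w p q| := abs_pos.2 hY
    have hx : 0 < |along v w p r| := abs_pos.2 hX
    by_cases h0 : |along v w p q| = 0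
    · rw [h0, mul_zero]; positivity
    · have : 0 < |along v w p q| := lt_of_le_of_ne (abs_nonneg _) (Ne.symm h0)
      calc _ < δ * |along v w p r| * |along v w p q| := by gcongr
        _ = |along v w p r| * (δ * |along v w p q|) := by ring
        _ ≤ _ := by gcongr
  have h1 := abs_lt.1 hlt
  rcases lt_or_gt_of_ne (mul_ne_zero hX hY) with h | h
  · rw [abs_of_neg h] at h1
    rw [isign_neg_of_neg h, isign_neg_of_neg (by linarith)]
  · rw [abs_of_pos h] at h1
    rw [isign_pos h, isign_pos (by linarith)]

open Classical in
/-- Rotating a line about `p` through the wedge: if the balance of the points at the start is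
positive and at the end negative, then the halving edges at `p` pointing forward in the wedge
outnumber those pointing backward by exactly one. -/
lemma sum_isign_along_halving {H : Finset Pt} (hH : GenPos H) (hev : Even #H) {v w p : Pt}
    (hvw : v ≠ w) (hp : p ∈ H) {δ : ℝ} (hδ : 0 < δ)
    (hpos : 0 < ∑ q ∈ H, if InWedge v w δ p q then isign (along v w p q)
      else isign (across v w p q))
    (hneg : ∑ q ∈ H, (if InWedge v w δ p q then -isign (along v w p q)
      else isign (across v w p q)) < 0) :
    ∑ r ∈ H, (if InWedge v w δ p r ∧ HalvingEdge H p r then isign (along v w p r) else 0) = 1 := by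
  set T := {q ∈ H | InWedge v w δ p q} with hT
  set N := {q ∈ H | ¬ InWedge v w δ p q} with hN
  set s : Pt → ℝ := fun q => across v w p q / along v w p q with hs
  set a : Pt → ℤ := fun q => isign (along v w p q) with ha
  set c : ℤ := ∑ q ∈ N, isign (across v w p q) with hc
  have hTm : ∀ q, q ∈ T ↔ q ∈ H ∧ InWedge v w δ p q := by simp [hT]
  have hNm : ∀ q, q ∈ N ↔ q ∈ H ∧ ¬ InWedge v w δ p q := by simp [hN]
  rw [sum_ite, ← hT, ← hN] at hpos hneg
  rw [sum_neg_distrib] at hneg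
  have hsum : ∀ r ∈ T, ∑ q ∈ H, isign (det2 p r q) =
      a r * (c + ∑ q ∈ T, a q * isign (s q - s r)) := by
    intro r hr
    rw [← sum_filter_add_sum_filter_not H (InWedge v w δ p), ← hT, ← hN, mul_add, mul_sum,
      mul_sum, add_comm]
    congr 1
    · exact sum_congr rfl fun q hq =>
        isign_det2_of_not_inWedge hδ hvw ((hTm r).1 hr).2 ((hNm q).1 hq).2
    · exact sum_congr rfl fun q hq =>
        isign_det2_of_inWedge hvw ((hTm r).1 hr).2 ((hTm q).1 hq).2
  have ha1 : ∀ q ∈ T, a q = 1 ∨ a q = -1 := fun q hq =>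
    isign_eq_one_or ((hTm q).1 hq).2.along_ne_zero
  have hinj : Set.InjOn s T := by
    intro q hq r hr hqr
    by_contra hne
    obtain ⟨hqH, hqW⟩ := (hTm q).1 hq
    obtain ⟨hrH, hrW⟩ := (hTm r).1 hr
    apply hH.det2_ne_zero hp hqH hrH hqW.ne hrW.ne hne
    have h1 := along_mul_det2 v w p q r
    have h2 := hqW.along_ne_zero
    have h3 := hrW.along_ne_zero
    simp only [hs] at hqr
    rw [div_eq_div_iff h2 h3] at hqr
    have h4 : along v w v w * det2 p q r = 0 := by rw [h1]; linarith
    exact (mul_eq_zero.1 h4).resolve_left (along_self_pos hvw).ne'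
  have hpN : p ∈ N := (hNm p).2 ⟨hp, fun h => h.ne rfl⟩
  have hodd : Odd (c + #T) := by
    have h1 : c = ∑ q ∈ N.erase p, isign (across v w p q) := by
      rw [hc, ← add_sum_erase N _ hpN]
      have : across v w p p = 0 := by unfold across; ring
      rw [this, isign_zero, zero_add]
    have h2 := even_sum_add_card (fun q => isign (across v w p q)) (N.erase p) fun q hq => by
      obtain ⟨hq1, hq2⟩ := mem_erase.1 hq
      exact isign_eq_one_or
        (across_ne_zero_of_not_inWedge hδ hvw hq1.symm ((hNm q).1 hq2).2)
    rw [← h1] at h2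
    have h3 := card_erase_add_one hpN
    have h4 : #T + #N = #H := card_filter_add_card_filter_not _
    obtain ⟨m, hm⟩ := hev
    obtain ⟨i, hi⟩ := h2
    exact ⟨i + #T - m, by omega⟩
  have key := sum_zero_crossings s a T hinj ha1 c hodd
  rw [if_pos (by linarith), if_neg (by linarith), sub_zero] at key
  rw [← key, hT, sum_filter]
  refine sum_congr rfl fun r hr => ?_
  by_cases hW : InWedge v w δ p r
  · have hrT : r ∈ T := (hTm r).2 ⟨hr, hW⟩
    have har : a r ≠ 0 := by rcases ha1 r hrT with h | h <;> rw [h] <;> decide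
    have hiff : HalvingEdge H p r ↔ c + ∑ q ∈ T, a q * isign (s q - s r) = 0 := by
      rw [halvingEdge_iff_sum_isign hH hev hp hr hW.ne, hsum r hrT, mul_eq_zero,
        or_iff_right har]
    simp only [hW, true_and, if_true, hiff, ha]
    rfl
  · simp [hW]

/-- Points within `ε` of points of `S` behave, with respect to the wedge of aperture `δ` around
the direction `w - v` at a point near `v`, like the points of `S` that they approximate. -/
structure WedgeApprox (S : Finset Pt) (v w : Pt) (δ ε : ℝ) : Prop where
  near_head : ∀ p r, dist p v ≤ ε → dist r w ≤ ε → InWedge v w δ p r ∧ 0 < along v w p r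
  near_other : ∀ u ∈ S, u ≠ v → u ≠ w → ∀ p r, dist p v ≤ ε → dist r u ≤ ε →
    ¬ InWedge v w δ p r ∧ isign (across v w p r) = isign (det2 v w u)

lemma eventually_forall_near {P : Pt × Pt → Prop} {v u : Pt} (h : ∀ᶠ z in 𝓝 (v, u), P z) :
    ∀ᶠ ε : ℝ in 𝓝[>] 0, ∀ p r, dist p v ≤ ε → dist r u ≤ ε → P (p, r) := by
  obtain ⟨η, hη, hP⟩ := Metric.eventually_nhds_iff.1 h
  filter_upwards [nhdsWithin_le_nhds (Iio_mem_nhds hη)] with ε hε p r hp hr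
  refine hP ?_
  rw [Prod.dist_eq]
  exact max_lt (hp.trans_lt hε) (hr.trans_lt hε)

lemma eventually_wedgeApprox {S : Finset Pt} (hS : GenPos S) {v w : Pt} (hv : v ∈ S)
    (hw : w ∈ S) (hvw : v ≠ w) :
    ∃ δ > 0, ∀ᶠ ε : ℝ in 𝓝[>] 0, WedgeApprox S v w δ ε := by
  have hcX : Continuous fun z : Pt × Pt => along v w z.1 z.2 := by unfold along; fun_prop
  have hcY : Continuous fun z : Pt × Pt => across v w z.1 z.2 := by unfold across; fun_prop
  have hdet : ∀ u ∈ S, u ≠ v → u ≠ w → across v w v u ≠ 0 := fun u hu h1 h2 =>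
    hS.det2_ne_zero hv hw hu hvw h1.symm h2.symm
  have hδ : ∀ᶠ δ : ℝ in 𝓝[>] 0, ∀ u ∈ S, u ≠ v → u ≠ w →
      δ * |along v w v u| < |across v w v u| := by
    rw [eventually_all_finset]
    intro u hu
    by_cases h1 : u = v
    · exact Eventually.of_forall fun _ h => absurd h1 h
    by_cases h2 : u = w
    · exact Eventually.of_forall fun _ _ h => absurd h2 h
    have hlim : Tendsto (fun δ : ℝ => δ * |along v w v u|) (𝓝[>] 0) (𝓝 0) := by
      have : Continuous fun δ : ℝ => δ * |along v w v u| := by fun_prop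
      simpa using (this.tendsto 0).mono_left nhdsWithin_le_nhds
    filter_upwards [hlim.eventually_lt_const (abs_pos.2 (hdet u hu h1 h2))] with δ h _ _ using h
  obtain ⟨δ, hδ, hδ0⟩ := (hδ.and self_mem_nhdsWithin).exists
  have hδ0 : 0 < δ := hδ0
  refine ⟨δ, hδ0, ?_⟩
  have e1 : ∀ᶠ ε : ℝ in 𝓝[>] 0, ∀ p r, dist p v ≤ ε → dist r w ≤ ε →
      InWedge v w δ p r ∧ 0 < along v w p r := by
    refine eventually_forall_near (P := fun z => InWedge v w δ z.1 z.2 ∧ 0 < along v w z.1 z.2) ?_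
    have hpos := along_self_pos hvw
    refine Eventually.and ?_ (hcX.continuousAt.eventually_const_lt hpos)
    refine ContinuousAt.eventually_lt (f := fun z : Pt × Pt => |across v w z.1 z.2|)
      (g := fun z => δ * |along v w z.1 z.2|) (by fun_prop) (by fun_prop) ?_
    have : across v w v w = 0 := by unfold across; ring
    simp only [this, abs_zero]
    positivity
  have e2 : ∀ᶠ ε : ℝ in 𝓝[>] 0, ∀ u ∈ S, u ≠ v → u ≠ w → ∀ p r, dist p v ≤ ε → dist r u ≤ ε →
      ¬ InWedge v w δ p r ∧ isign (across v w p r) = isign (det2 v w u) := by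
    rw [eventually_all_finset]
    intro u hu
    by_cases h1 : u = v
    · exact Eventually.of_forall fun _ h => absurd h1 h
    by_cases h2 : u = w
    · exact Eventually.of_forall fun _ _ h => absurd h2 h
    have h3 : ∀ᶠ z : Pt × Pt in 𝓝 (v, u), ¬ InWedge v w δ z.1 z.2 ∧
        isign (across v w z.1 z.2) = isign (det2 v w u) := by
      refine Eventually.and ?_ ?_
      · have := ContinuousAt.eventually_lt (x₀ := (v, u))
          (f := fun z : Pt × Pt => δ * |along v w z.1 z.2|)
          (g := fun z => |across v w z.1 z.2|) (by fun_prop) (by fun_prop) (hδ u hu h1 h2)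
        filter_upwards [this] with z hz
        exact not_lt.2 hz.le
      · have hY : across v w v u = det2 v w u := rfl
        rcases lt_or_gt_of_ne (hdet u hu h1 h2) with h | h
        · filter_upwards [(hcY.continuousAt (x := (v, u))).eventually_lt_const h] with z hz
          rw [isign_neg_of_neg hz, isign_neg_of_neg (hY ▸ h)]
        · filter_upwards [(hcY.continuousAt (x := (v, u))).eventually_const_lt h] with z hz
          rw [isign_pos hz, isign_pos (hY ▸ h)]
    filter_upwards [eventually_forall_near h3] with ε hε _ _ using hε
  filter_upwards [e1, e2] with ε h1 h2 using ⟨h1, h2⟩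

section Fission

variable {S : Finset Pt} {k : ℕ} {ε : ℝ} {H : Finset Pt} {cl : Pt → Finset Pt}

lemma IsFission.mem_iff (hf : IsFission S k ε H cl) {x : Pt} :
    x ∈ H ↔ ∃ v ∈ S, x ∈ cl v := by
  rw [← mem_coe, hf.union_eq]; simp

lemma IsFission.sum_eq (hf : IsFission S k ε H cl) (g : Pt → ℤ) :
    ∑ x ∈ H, g x = ∑ v ∈ S, ∑ x ∈ cl v, g x := by
  classical
  have : H = S.biUnion cl := by
    ext x; rw [hf.mem_iff, mem_biUnion]
  rw [this, sum_biUnion]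
  exact fun v hv w hw h => hf.disj v hv w hw h

lemma IsFission.card_eq (hf : IsFission S k ε H cl) : #H = #S * k := by
  have h := hf.sum_eq fun _ => 1
  simp only [sum_const, nsmul_eq_mul, mul_one] at h
  rw [sum_congr rfl fun v hv => by rw [hf.cluster_card v hv], sum_const, nsmul_eq_mul] at h
  exact_mod_cast h

/-- If the contributions of the other clusters cancel as for a halving edge `{v, w}` of `S`,
a sum over `H` reduces to the sums over the `v`-cluster and the `w`-cluster. -/
lemma IsFission.sum_eq_of_halvingEdge (hf : IsFission S k ε H cl) {v w : Pt}
    (hvw : HalvingEdge S v w) (g : Pt → ℤ)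
    (hg : ∀ u ∈ S, u ≠ v → u ≠ w → ∀ x ∈ cl u, g x = isign (det2 v w u)) :
    ∑ x ∈ H, g x = ∑ x ∈ cl v, g x + ∑ x ∈ cl w, g x := by
  classical
  have h0 := hvw.sum_isign_eq_zero
  have h1 : ∑ u ∈ S, (∑ x ∈ cl u, g x - k * isign (det2 v w u)) =
      ∑ x ∈ cl v, g x + ∑ x ∈ cl w, g x := by
    rw [sum_eq_add_of_mem v w hvw.1 hvw.2.1 hvw.2.2.1]
    · have e1 : det2 v w v = 0 := by unfold det2; ring
      have e2 : det2 v w w = 0 := by unfold det2; ring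
      rw [e1, e2, isign_zero]; ring
    · rintro u hu ⟨hv, hw⟩
      rw [sum_congr rfl (hg u hu hv hw), sum_const, hf.cluster_card u hu, nsmul_eq_mul, sub_self]
  rw [hf.sum_eq, ← h1, sum_sub_distrib, ← mul_sum, h0, mul_zero, sub_zero]

open Classical in
/-- The halving edges at `p` inside the wedge around `w - v`, counted with orientation. -/
lemma IsFission.sum_isign_along_halving (hf : IsFission S k ε H cl) (hev : Even #S) {v w p : Pt}
    (hvw : HalvingEdge S v w) {δ : ℝ} (hδ : 0 < δ) (hA : WedgeApprox S v w δ ε)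
    (hp : p ∈ cl v) :
    ∑ r ∈ cl v, (if InWedge v w δ p r ∧ HalvingEdge H p r then isign (along v w p r) else 0) +
      #{r ∈ cl w | HalvingEdge H p r} = 1 := by
  have hv := hvw.1
  have hw := hvw.2.1
  have hpv := hf.close v hv p hp
  have hpH : p ∈ H := hf.mem_iff.2 ⟨v, hv, hp⟩
  have hother : ∀ u ∈ S, u ≠ v → u ≠ w → ∀ x ∈ cl u,
      ¬ InWedge v w δ p x ∧ isign (across v w p x) = isign (det2 v w u) := fun u hu h1 h2 x hx =>
    hA.near_other u hu h1 h2 p x hpv (hf.close u hu x hx)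
  have hhead : ∀ x ∈ cl w, InWedge v w δ p x ∧ 0 < along v w p x := fun x hx =>
    hA.near_head p x hpv (hf.close w hw x hx)
  have hbound : ∀ g : Pt → ℤ, g p = 0 → (∀ x, |g x| ≤ 1) → |∑ x ∈ cl v, g x| < k := by
    intro g h0 h1
    rw [← add_sum_erase _ _ hp, h0, zero_add]
    have h2 : ∑ x ∈ (cl v).erase p, |g x| ≤ ∑ x ∈ (cl v).erase p, 1 :=
      sum_le_sum fun x _ => h1 x
    have h3 := card_erase_add_one hp
    rw [hf.cluster_card v hv] at h3
    have h4 := abs_sum_le_sum_abs g ((cl v).erase p)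
    simp only [sum_const, nsmul_eq_mul, mul_one] at h2
    omega
  have hpp : ¬ InWedge v w δ p p := fun h => h.ne rfl
  have hpp0 : across v w p p = 0 := by unfold across; ring
  have key := _root_.sum_isign_along_halving hf.genPos (by
      rw [hf.card_eq]; exact hev.mul_right k) hvw.2.2.1 hpH hδ (by
      rw [hf.sum_eq_of_halvingEdge hvw _ fun u hu h1 h2 x hx => by
        rw [if_neg (hother u hu h1 h2 x hx).1, (hother u hu h1 h2 x hx).2]]
      have h1 := hbound (fun q => if InWedge v w δ p q then isign (along v w p q)
        else isign (across v w p q)) (by simp [hpp, hpp0, isign_zero]) (fun x => by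
          split_ifs <;> exact abs_isign_le_one _)
      have h2 : ∑ q ∈ cl w, (if InWedge v w δ p q then isign (along v w p q)
          else isign (across v w p q)) = k := by
        rw [sum_congr rfl fun x hx => by rw [if_pos (hhead x hx).1, isign_pos (hhead x hx).2],
          sum_const, hf.cluster_card w hw]; simp
      rw [h2]
      linarith [(abs_lt.1 h1).1]) (by
      rw [hf.sum_eq_of_halvingEdge hvw _ fun u hu h1 h2 x hx => by
        rw [if_neg (hother u hu h1 h2 x hx).1, (hother u hu h1 h2 x hx).2]]
      have h1 := hbound (fun q => if InWedge v w δ p q then -isign (along v w p q)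
        else isign (across v w p q)) (by simp [hpp, hpp0, isign_zero]) (fun x => by
          split_ifs
          · rw [abs_neg]; exact abs_isign_le_one _
          · exact abs_isign_le_one _)
      have h2 : ∑ q ∈ cl w, (if InWedge v w δ p q then -isign (along v w p q)
          else isign (across v w p q)) = -k := by
        rw [sum_congr rfl fun x hx => by rw [if_pos (hhead x hx).1, isign_pos (hhead x hx).2],
          sum_const, hf.cluster_card w hw]; simp
      rw [h2]
      linarith [(abs_lt.1 h1).2])
  rw [← key, hf.sum_eq, sum_eq_add_of_mem v w hv hw hvw.2.2.1]
  · congr 1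
    rw [card_filter]
    push_cast
    refine sum_congr rfl fun x hx => ?_
    simp [(hhead x hx).1, isign_pos (hhead x hx).2]
  · rintro u hu ⟨h1, h2⟩
    refine sum_eq_zero fun x hx => ?_
    simp [(hother u hu h1 h2 x hx).1]

open Classical in
/-- For a union `C` of components of the halving graph of `H`, the number of halving edges in `C`
traversing the clusters of a halving edge `{v, w}` is the number of points of `C` in either. -/
lemma IsFission.sum_card_halving (hf : IsFission S k ε H cl) (hev : Even #S) {v w : Pt}
    (hvw : HalvingEdge S v w) {δ : ℝ} (hδ : 0 < δ) (hA : WedgeApprox S v w δ ε)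
    {C : Pt → Prop} (hC : ∀ p q, HalvingEdge H p q → (C p ↔ C q)) :
    ∑ p ∈ cl v, ∑ q ∈ cl w, (if C p ∧ C q ∧ HalvingEdge H p q then 1 else 0 : ℤ) =
      #{p ∈ cl v | C p} := by
  set F : Pt → Pt → ℤ := fun p r =>
    if C p ∧ InWedge v w δ p r ∧ HalvingEdge H p r then isign (along v w p r) else 0 with hF
  have hanti : ∀ p r, F r p = -F p r := by
    intro p r
    have hiff : (C r ∧ InWedge v w δ r p ∧ HalvingEdge H r p) ↔
        (C p ∧ InWedge v w δ p r ∧ HalvingEdge H p r) :=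
      ⟨fun ⟨h1, h2, h3⟩ => ⟨(hC _ _ h3).1 h1, h2.symm, h3.symm⟩,
        fun ⟨h1, h2, h3⟩ => ⟨(hC _ _ h3).1 h1, h2.symm, h3.symm⟩⟩
    simp only [hF]
    rw [if_congr hiff rfl rfl, along_swap, isign_neg]
    split_ifs <;> simp
  have hzero : ∑ p ∈ cl v, ∑ r ∈ cl v, F p r = 0 := by
    have h : ∑ p ∈ cl v, ∑ r ∈ cl v, F p r = -∑ p ∈ cl v, ∑ r ∈ cl v, F p r := by
      conv_lhs => rw [sum_comm]
      simp only [← sum_neg_distrib]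
      exact sum_congr rfl fun p _ => sum_congr rfl fun r _ => hanti p r
    linarith
  have hrow : ∀ p ∈ cl v, ∑ r ∈ cl v, F p r +
      ∑ q ∈ cl w, (if C p ∧ C q ∧ HalvingEdge H p q then 1 else 0 : ℤ) =
      if C p then 1 else 0 := by
    intro p hp
    by_cases hCp : C p
    · have h := hf.sum_isign_along_halving hev hvw hδ hA hp
      rw [card_filter] at h
      push_cast at h
      rw [if_pos hCp]
      refine Eq.trans ?_ h
      simp only [hF, hCp, true_and]
      congr 1
      refine sum_congr rfl fun q _ => ?_
      have : (C q ∧ HalvingEdge H p q) ↔ HalvingEdge H p q :=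
        ⟨fun h => h.2, fun h => ⟨(hC _ _ h).1 hCp, h⟩⟩
      simp only [this]
    · simp [hF, hCp]
  rw [card_filter]
  push_cast
  rw [← sum_congr rfl hrow, sum_add_distrib, hzero, zero_add]

open Classical in
lemma IsFission.card_filter_eq_of_halvingEdge (hf : IsFission S k ε H cl) (hev : Even #S)
    (hA : ∀ v ∈ S, ∀ w ∈ S, v ≠ w → ∃ δ > 0, WedgeApprox S v w δ ε)
    {C : Pt → Prop} (hC : ∀ p q, HalvingEdge H p q → (C p ↔ C q)) {v w : Pt}
    (hvw : HalvingEdge S v w) : #{p ∈ cl v | C p} = #{p ∈ cl w | C p} := by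
  obtain ⟨δ, hδ, hA1⟩ := hA v hvw.1 w hvw.2.1 hvw.2.2.1
  obtain ⟨δ', hδ', hA2⟩ := hA w hvw.2.1 v hvw.1 hvw.2.2.1.symm
  have h1 := hf.sum_card_halving hev hvw hδ hA1 hC
  have h2 := hf.sum_card_halving hev hvw.symm hδ' hA2 hC
  have h3 : (#{p ∈ cl v | C p} : ℤ) = #{p ∈ cl w | C p} := by
    rw [← h1, ← h2, sum_comm]
    refine sum_congr rfl fun q _ => sum_congr rfl fun p _ => ?_
    exact if_congr ⟨fun h => ⟨h.2.1, h.1, h.2.2.symm⟩, fun h => ⟨h.2.1, h.1, h.2.2.symm⟩⟩ rfl rfl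
  exact_mod_cast h3

end Fission

lemma halvingEdge_of_adj {S : Finset Pt} {p q : Pt} (h : (halvingGraph S).Adj p q) :
    HalvingEdge S p q := by
  rw [halvingGraph, SimpleGraph.fromRel_adj] at h
  exact h.2.elim id HalvingEdge.symm

lemma HalvingEdge.adj {S : Finset Pt} {p q : Pt} (h : HalvingEdge S p q) :
    (halvingGraph S).Adj p q := by
  rw [halvingGraph, SimpleGraph.fromRel_adj]
  exact ⟨h.2.2.1, Or.inl h⟩

lemma exists_forall_wedgeApprox {S : Finset Pt} (hS : GenPos S) :
    ∃ ε₀ > 0, ∀ ε : ℝ, 0 < ε → ε ≤ ε₀ →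
      ∀ v ∈ S, ∀ w ∈ S, v ≠ w → ∃ δ > 0, WedgeApprox S v w δ ε := by
  have h : ∀ᶠ ε : ℝ in 𝓝[>] 0,
      ∀ v ∈ S, ∀ w ∈ S, v ≠ w → ∃ δ > 0, WedgeApprox S v w δ ε := by
    rw [eventually_all_finset]
    intro v hv
    rw [eventually_all_finset]
    intro w hw
    by_cases hvw : v = w
    · exact Eventually.of_forall fun _ h => absurd hvw h
    obtain ⟨δ, hδ, hA⟩ := eventually_wedgeApprox hS hv hw hvw
    filter_upwards [hA] with ε hε _ using ⟨δ, hδ, hε⟩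
  obtain ⟨η, hη, hsub⟩ := mem_nhdsGT_iff_exists_Ioc_subset.1 h
  exact ⟨η, hη, fun ε h0 h1 => hsub ⟨h0, h1⟩⟩

lemma card_cluster_reachable_eq {S : Finset Pt} {k : ℕ} {ε : ℝ} {H : Finset Pt}
    {cl : Pt → Finset Pt} (hf : IsFission S k ε H cl) (hev : Even #S)
    (hA : ∀ v ∈ S, ∀ w ∈ S, v ≠ w → ∃ δ > 0, WedgeApprox S v w δ ε) (x : Pt) {v w : Pt}
    (hvw : (halvingGraph S).Reachable v w) :
    {y ∈ (cl v : Set Pt) | (halvingGraph H).Reachable x y}.ncard =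
      {y ∈ (cl w : Set Pt) | (halvingGraph H).Reachable x y}.ncard := by
  classical
  have hC : ∀ p q, HalvingEdge H p q →
      ((halvingGraph H).Reachable x p ↔ (halvingGraph H).Reachable x q) := fun p q h =>
    ⟨fun hr => hr.trans h.adj.reachable, fun hr => hr.trans h.symm.adj.reachable⟩
  rw [ncard_sep_eq_card_filter, ncard_sep_eq_card_filter]
  obtain ⟨walk⟩ := hvw
  induction walk with
  | nil => rfl
  | cons hadj _ ih =>
    refine Eq.trans ?_ ih
    convert hf.card_filter_eq_of_halvingEdge hev hA hC (halvingEdge_of_adj hadj)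

end

theorem stmt11 (S : Finset Pt) (hS : GenPos S) (hcard : Even S.card)
    (k : ℕ) (hk : 1 ≤ k) :
    ∃ ε₀ > 0, ∀ ε : ℝ, 0 < ε → ε ≤ ε₀ →
      ∀ (H : Finset Pt) (cl : Pt → Finset Pt), IsFission S k ε H cl →
        (∀ p ∈ S, ∀ q ∈ S, (halvingGraph S).Reachable p q) →
          (∀ x ∈ H, ∀ v ∈ S, ∃ y ∈ cl v, (halvingGraph H).Reachable x y) ∧
          (∀ x ∈ H, ∀ v ∈ S, ∀ w ∈ S,
            {y ∈ (cl v : Set Pt) | (halvingGraph H).Reachable x y}.ncard =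
            {y ∈ (cl w : Set Pt) | (halvingGraph H).Reachable x y}.ncard) := by
  obtain ⟨ε₀, hε₀, hA⟩ := exists_forall_wedgeApprox hS
  refine ⟨ε₀, hε₀, fun ε h0 h1 H cl hf hconn => ?_⟩
  have hcount := fun x v hv w hw =>
    card_cluster_reachable_eq hf hcard (hA ε h0 h1) x (hconn v hv w hw)
  refine ⟨fun x hx v hv => ?_, fun x _ v hv w hw => hcount x v hv w hw⟩
  obtain ⟨u, hu, hxu⟩ := hf.mem_iff.1 hx
  have hpos : 0 < {y ∈ (cl u : Set Pt) | (halvingGraph H).Reachable x y}.ncard :=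
    (Set.ncard_pos ((cl u).finite_toSet.subset (Set.sep_subset _ _))).2
      ⟨x, hxu, SimpleGraph.Reachable.refl x⟩
  rw [hcount x u hu v hv] at hpos
  obtain ⟨y, hy⟩ := Set.nonempty_of_ncard_ne_zero hpos.ne'
  exact ⟨y, hy.1, hy.2⟩

end
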